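/- For every n ≥ 1 and k ≥ 1, the number of boolean signed permutations in S_n^B of length k equals Σ_{i=1}^{k} C(n+1−i, k+1−i)·C(k−1, i−1), where C(a,b) denotes the binomial coefficient (equal to 0 when b > a or b < 0); the number of boolean signed permutations of length 0 is 1. -/

import Mathlib

namespace Paper

/-! ### Type A: the symmetric group `S_n` as `Equiv.Perm (Fin n)` -/

/-- The simple transposition `s_i ∈ S_n` (1-indexed letter `i`, meaningful for
`1 ≤ i ≤ n-1`): it interchanges the entries in (1-indexed) positions `i` and `i+1`,
i.e. (0-indexed) positions `i-1` and `i` of `Fin n`. Out-of-range letters give `1`. -/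
def sA (n : ℕ) (i : ℕ) : Equiv.Perm (Fin n) :=
  if h : 1 ≤ i ∧ i < n then Equiv.swap ⟨i - 1, by omega⟩ ⟨i, h.2⟩ else 1

/-- The product `s_{i_1} ⋯ s_{i_ℓ}` of a word `i_1 ⋯ i_ℓ`. -/
def prodA (n : ℕ) (w : List ℕ) : Equiv.Perm (Fin n) := (w.map (sA n)).prod

/-- A word in the letters `{1, …, n-1}`. -/
def IsWordA (n : ℕ) (w : List ℕ) : Prop := ∀ i ∈ w, 1 ≤ i ∧ i ≤ n - 1

/-- `w` is a reduced decomposition of `x ∈ S_n`. -/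
def ReducedA (n : ℕ) (w : List ℕ) (x : Equiv.Perm (Fin n)) : Prop :=
  IsWordA n w ∧ prodA n w = x ∧
    ∀ w' : List ℕ, IsWordA n w' → prodA n w' = x → w.length ≤ w'.length

/-- The Coxeter length `ℓ(x)`: minimal length of a word for `x`. -/
noncomputable def lenA (n : ℕ) (x : Equiv.Perm (Fin n)) : ℕ :=
  sInf {l | ∃ w : List ℕ, IsWordA n w ∧ prodA n w = x ∧ w.length = l}

/-- Bruhat order on `S_n`: `v ≤ w` iff some reduced decomposition of `v` is a
(not necessarily consecutive) subword of some reduced decomposition of `w`. -/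
def bruhatA (n : ℕ) (v w : Equiv.Perm (Fin n)) : Prop :=
  ∃ a b : List ℕ, ReducedA n a v ∧ ReducedA n b w ∧ a.Sublist b

/-- `w ∈ S_n` is boolean: the principal order ideal `B(w)`, ordered by the Bruhat
order, is order-isomorphic to the lattice of all subsets of `{1,…,r}` for some `r`. -/
def BooleanA (n : ℕ) (w : Equiv.Perm (Fin n)) : Prop :=
  ∃ (r : ℕ) (e : {v : Equiv.Perm (Fin n) // bruhatA n v w} ≃ Finset (Fin r)),
    ∀ a b : {v : Equiv.Perm (Fin n) // bruhatA n v w}, bruhatA n a.1 b.1 ↔ e a ⊆ e b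

/-- Pattern containment: `w ∈ S_n` contains `p ∈ S_k`. -/
def ContainsA {n k : ℕ} (w : Equiv.Perm (Fin n)) (p : Equiv.Perm (Fin k)) : Prop :=
  ∃ f : Fin k → Fin n, StrictMono f ∧ ∀ a b : Fin k, w (f a) < w (f b) ↔ p a < p b

/-- Pattern avoidance. -/
def AvoidsA {n k : ℕ} (w : Equiv.Perm (Fin n)) (p : Equiv.Perm (Fin k)) : Prop :=
  ¬ ContainsA w p

/-- The pattern `321` (one-line notation). -/
def p321 : Equiv.Perm (Fin 3) := ⟨![2,1,0], ![2,1,0], by decide, by decide⟩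
/-- The pattern `231` (one-line notation). -/
def p231 : Equiv.Perm (Fin 3) := ⟨![1,2,0], ![2,0,1], by decide, by decide⟩
/-- The pattern `312` (one-line notation). -/
def p312 : Equiv.Perm (Fin 3) := ⟨![2,0,1], ![1,2,0], by decide, by decide⟩
/-- The pattern `3412` (one-line notation). -/
def p3412 : Equiv.Perm (Fin 4) := ⟨![2,3,0,1], ![2,3,0,1], by decide, by decide⟩

/-- The longest (decreasing) permutation `w_0^{(k)} = k (k-1) ⋯ 2 1 ∈ S_k`. -/
def w0 (k : ℕ) : Equiv.Perm (Fin k) := Fin.revPerm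

/-- The shift of a word by `M`: each letter `i` becomes `i + M`. -/
def shift (M : ℕ) (w : List ℕ) : List ℕ := w.map (· + M)




/-! ### Types B and D: signed permutations, modelled as permutations `w` of `ℤ`
with `w(-x) = -w(x)` that fix all integers of absolute value `> n`. -/

/-- The simple generators of `S_n^B`, as permutations of `ℤ`:
`sB 0` negates the value `1`; for `i ≥ 1`, `sB i` interchanges the values
`i` and `i+1` (and `-i` and `-(i+1)`). -/
def sB : ℕ → Equiv.Perm ℤ
  | 0 => Equiv.swap 1 (-1)
  | (i+1) => Equiv.swap ((i : ℤ) + 1) ((i : ℤ) + 2) * Equiv.swap (-((i : ℤ) + 1)) (-((i : ℤ) + 2))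

/-- The simple generators of `S_n^D`: letter `0` encodes `s_{1'} = s_0 s_1 s_0`
(mapping `1 ↦ -2` and `2 ↦ -1`), and letters `i ≥ 1` are as in type `B`. -/
def sD : ℕ → Equiv.Perm ℤ
  | 0 => sB 0 * sB 1 * sB 0
  | (i+1) => sB (i+1)

def prodB (w : List ℕ) : Equiv.Perm ℤ := (w.map sB).prod
def prodD (w : List ℕ) : Equiv.Perm ℤ := (w.map sD).prod

/-- A word in the type `B`/`D` letters `{0, 1, …, n-1}`. -/
def IsWordBD (n : ℕ) (w : List ℕ) : Prop := ∀ i ∈ w, i ≤ n - 1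

/-- `w` is a reduced decomposition of `x ∈ S_n^B`. -/
def ReducedB (n : ℕ) (w : List ℕ) (x : Equiv.Perm ℤ) : Prop :=
  IsWordBD n w ∧ prodB w = x ∧
    ∀ w' : List ℕ, IsWordBD n w' → prodB w' = x → w.length ≤ w'.length

/-- `w` is a reduced decomposition of `x ∈ S_n^D`. -/
def ReducedD (n : ℕ) (w : List ℕ) (x : Equiv.Perm ℤ) : Prop :=
  IsWordBD n w ∧ prodD w = x ∧
    ∀ w' : List ℕ, IsWordBD n w' → prodD w' = x → w.length ≤ w'.length

/-- Length in `S_n^B`. -/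
noncomputable def lenB (n : ℕ) (x : Equiv.Perm ℤ) : ℕ :=
  sInf {l | ∃ w : List ℕ, IsWordBD n w ∧ prodB w = x ∧ w.length = l}

/-- Length in `S_n^D`. -/
noncomputable def lenD (n : ℕ) (x : Equiv.Perm ℤ) : ℕ :=
  sInf {l | ∃ w : List ℕ, IsWordBD n w ∧ prodD w = x ∧ w.length = l}

/-- Bruhat order on `S_n^B`. -/
def bruhatB (n : ℕ) (v w : Equiv.Perm ℤ) : Prop :=
  ∃ a b : List ℕ, ReducedB n a v ∧ ReducedB n b w ∧ a.Sublist b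

/-- Bruhat order on `S_n^D`. -/
def bruhatD (n : ℕ) (v w : Equiv.Perm ℤ) : Prop :=
  ∃ a b : List ℕ, ReducedD n a v ∧ ReducedD n b w ∧ a.Sublist b

/-- `w` is an element of `S_n^B`: an "odd" permutation of `{±1, …, ±n}`. -/
def IsSignedPerm (n : ℕ) (w : Equiv.Perm ℤ) : Prop :=
  (∀ x : ℤ, w (-x) = - w x) ∧ ∀ x : ℤ, (n : ℤ) < |x| → w x = x

/-- `w` is an element of `S_n^D`: a signed permutation with an even number of
negative values in its one-line notation. -/
def IsTypeD (n : ℕ) (w : Equiv.Perm ℤ) : Prop :=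
  IsSignedPerm n w ∧ Even (((Finset.Icc (1 : ℤ) n).filter (fun x => w x < 0)).card)

/-- `w ∈ S_n^B` is boolean (for the type `B` Bruhat order). -/
def BooleanB (n : ℕ) (w : Equiv.Perm ℤ) : Prop :=
  ∃ (r : ℕ) (e : {v : Equiv.Perm ℤ // bruhatB n v w} ≃ Finset (Fin r)),
    ∀ a b : {v : Equiv.Perm ℤ // bruhatB n v w}, bruhatB n a.1 b.1 ↔ e a ⊆ e b

/-- `w ∈ S_n^D` is boolean (for the type `D` Bruhat order). -/
def BooleanD (n : ℕ) (w : Equiv.Perm ℤ) : Prop :=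
  ∃ (r : ℕ) (e : {v : Equiv.Perm ℤ // bruhatD n v w} ≃ Finset (Fin r)),
    ∀ a b : {v : Equiv.Perm ℤ // bruhatD n v w}, bruhatD n a.1 b.1 ↔ e a ⊆ e b

/-- Signed pattern containment, where the pattern is given by its one-line
notation `p` (a list of nonzero integers): there are positions
`1 ≤ f 0 < ⋯ < f (k-1) ≤ n` such that each `w (f j)` has the same sign as the
`j`-th entry of `p`, and the absolute values appear in the same relative order. -/
def containsPat (n : ℕ) (w : Equiv.Perm ℤ) (p : List ℤ) : Prop :=
  ∃ f : Fin p.length → ℤ, StrictMono f ∧ (∀ j, 1 ≤ f j ∧ f j ≤ (n : ℤ)) ∧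
    (∀ j, 0 < w (f j) ↔ 0 < p.get j) ∧
    (∀ j j', |w (f j)| < |w (f j')| ↔ |p.get j| < |p.get j'|)

/-- Signed pattern avoidance. -/
def avoidsPat (n : ℕ) (w : Equiv.Perm ℤ) (p : List ℤ) : Prop := ¬ containsPat n w p


/-! ### Extra definitions used in some statements -/

/-- `w ∈ S_n` is decomposable: `B(w) ≅ B(u) × B(v)` (as posets under Bruhat order)
for some `u ∈ S_m`, `v ∈ S_{m'}` with `m, m' < n`. -/
def Decomposable (n : ℕ) (w : Equiv.Perm (Fin n)) : Prop :=
  ∃ (m m' : ℕ), m < n ∧ m' < n ∧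
    ∃ (u : Equiv.Perm (Fin m)) (v : Equiv.Perm (Fin m'))
      (e : {x : Equiv.Perm (Fin n) // bruhatA n x w} ≃
        {y : Equiv.Perm (Fin m) // bruhatA m y u} × {z : Equiv.Perm (Fin m') // bruhatA m' z v}),
      ∀ a b : {x : Equiv.Perm (Fin n) // bruhatA n x w},
        bruhatA n a.1 b.1 ↔
          (bruhatA m ((e a).1).1 ((e b).1).1 ∧ bruhatA m' ((e a).2).1 ((e b).2).1)

/-- `w` is decreasing on the set of positions `T`. -/
def DecrOn (n : ℕ) (w : Equiv.Perm (Fin n)) (T : Finset (Fin n)) : Prop :=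
  ∀ a ∈ T, ∀ b ∈ T, a < b → w b < w a

/-- Every inversion of `w` lies in exactly one occurrence of the decreasing
pattern `w_0^{(k)}`: for every `i < j` with `w i > w j` there is exactly one
`k`-element set of positions containing `i` and `j` on which `w` is decreasing. -/
def EveryInvOnce (n k : ℕ) (w : Equiv.Perm (Fin n)) : Prop :=
  ∀ i j : Fin n, i < j → w j < w i →
    ∃! T : Finset (Fin n), T.card = k ∧ DecrOn n w T ∧ i ∈ T ∧ j ∈ T

/-- Equality of two patterns of (possibly a priori different) sizes. -/
def EqPat {k m : ℕ} (p : Equiv.Perm (Fin k)) (q : Equiv.Perm (Fin m)) : Prop :=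
  ∃ h : k = m, ∀ i : Fin k, ((p i : ℕ) = (q (Fin.cast h i) : ℕ))

/-- `L(n,k)`: the number of boolean permutations in `S_n` of length `k`. -/
noncomputable def LA (n k : ℕ) : ℕ :=
  Nat.card {w : Equiv.Perm (Fin n) // BooleanA n w ∧ lenA n w = k}

/-- `L` extended to integer arguments, with the convention that it vanishes
when `m < 1` or `j < 0`. -/
noncomputable def Lz (m j : ℤ) : ℤ :=
  if 1 ≤ m ∧ 0 ≤ j then (LA m.toNat j.toNat : ℤ) else 0

/-- `L^D(n,k)`: the number of boolean elements of `S_n^D` of length `k`. -/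
noncomputable def LD (n k : ℕ) : ℕ :=
  Nat.card {w : Equiv.Perm ℤ // IsTypeD n w ∧ BooleanD n w ∧ lenD n w = k}


lemma sB_succ_apply (i : ℕ) (x : ℤ) : sB (i+1) x =
    if x = i+1 then (i:ℤ)+2 else if x = i+2 then (i:ℤ)+1 else
    if x = -(i+1) then -((i:ℤ)+2) else if x = -(i+2) then -((i:ℤ)+1) else x := by
  simp only [sB, Equiv.Perm.mul_apply, Equiv.swap_apply_def]
  split_ifs <;> omega

lemma sB_zero_apply (x : ℤ) : sB 0 x =
    if x = 1 then -1 else if x = -1 then 1 else x := by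
  simp only [sB, Equiv.swap_apply_def]

lemma sB_sq (i : ℕ) : sB i * sB i = 1 := by
  cases i with
  | zero => exact Equiv.swap_mul_self _ _
  | succ i =>
    ext x
    simp only [Equiv.Perm.mul_apply, sB_succ_apply, Equiv.Perm.one_apply]
    split_ifs <;> omega

lemma sB_neg (i : ℕ) (x : ℤ) : sB i (-x) = - sB i x := by
  cases i with
  | zero =>
    simp only [sB_zero_apply]
    split_ifs <;> omega
  | succ i =>
    simp only [sB_succ_apply]
    split_ifs <;> omega

lemma sB_fix (i : ℕ) (x : ℤ) (h : (i:ℤ) + 1 < |x|) : sB i x = x := by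
  rw [lt_abs] at h
  cases i with
  | zero =>
    simp only [sB_zero_apply]
    split_ifs <;> omega
  | succ i =>
    simp only [sB_succ_apply]
    push_cast at h
    split_ifs <;> omega

lemma sB_pres (i j : ℕ) (h : j ≠ i) (x : ℤ) : (i:ℤ) < sB j x ↔ (i:ℤ) < x := by
  cases j with
  | zero =>
    simp only [sB_zero_apply]
    split_ifs <;> omega
  | succ j =>
    simp only [sB_succ_apply]
    split_ifs <;> omega

lemma sB_top (i : ℕ) : sB (i+1) ((i:ℤ)+2) = (i:ℤ)+1 := by
  simp only [sB_succ_apply]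
  split_ifs <;> omega

lemma sB_top' (i : ℕ) : sB (i+1) ((i:ℤ)+1) = (i:ℤ)+2 := by
  simp only [sB_succ_apply]
  split_ifs <;> omega

lemma sB_not_pres (i : ℕ) : ¬ (i:ℤ) < sB i ((i:ℤ)+1) := by
  cases i with
  | zero => simp [sB_zero_apply]
  | succ i =>
    have := sB_top i
    push_cast
    rw [show (i:ℤ)+1+1 = i+2 by ring, this]
    omega

lemma sB_comm {i j : ℕ} (h : i + 1 < j) : Commute (sB i) (sB j) := by
  obtain ⟨j, rfl⟩ : ∃ j', j = j' + 1 := ⟨j - 1, by omega⟩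
  apply Equiv.Perm.Disjoint.commute
  intro x
  cases i with
  | zero =>
    simp only [sB_zero_apply, sB_succ_apply]
    by_cases h0 : x = 1 ∨ x = -1
    · right
      split_ifs <;> omega
    · left
      split_ifs <;> omega
  | succ i =>
    simp only [sB_succ_apply]
    by_cases h0 : x = i + 1 ∨ x = i + 2 ∨ x = -(i+1) ∨ x = -(i+2)
    · right
      split_ifs <;> omega
    · left
      split_ifs <;> omega

@[simp] lemma prodB_nil : prodB [] = 1 := rfl

@[simp] lemma prodB_cons (a : ℕ) (l : List ℕ) : prodB (a :: l) = sB a * prodB l := by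
  simp [prodB]

@[simp] lemma prodB_append (l l' : List ℕ) : prodB (l ++ l') = prodB l * prodB l' := by
  simp [prodB]

lemma prodB_pres (i : ℕ) (w : List ℕ) (h : i ∉ w) (x : ℤ) :
    (i:ℤ) < prodB w x ↔ (i:ℤ) < x := by
  induction w with
  | nil => simp
  | cons a w ih =>
    simp only [List.mem_cons, not_or] at h
    rw [prodB_cons, Equiv.Perm.mul_apply, sB_pres i a (Ne.symm h.1), ih h.2]

lemma prodB_fix (m : ℕ) (w : List ℕ) (h : ∀ j ∈ w, j < m) (x : ℤ) (hx : (m:ℤ) < |x|) :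
    prodB w x = x := by
  induction w with
  | nil => simp
  | cons a w ih =>
    have ha := h a (by simp)
    rw [prodB_cons, Equiv.Perm.mul_apply, ih (fun j hj => h j (by simp [hj])), sB_fix]
    omega

lemma prodB_neg (w : List ℕ) (x : ℤ) : prodB w (-x) = - prodB w x := by
  induction w with
  | nil => simp
  | cons a w ih => simp [Equiv.Perm.mul_apply, ih, sB_neg]

lemma prodB_commute (w : List ℕ) (g : Equiv.Perm ℤ) (h : ∀ j ∈ w, Commute (sB j) g) :
    Commute (prodB w) g := by
  induction w with
  | nil => simp
  | cons a w ih =>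
    rw [prodB_cons]
    exact (h a (by simp)).mul_left (ih fun j hj => h j (by simp [hj]))

lemma nodup_not_pres (b : List ℕ) (hb : b.Nodup) (i : ℕ) (hi : i ∈ b) :
    ¬ ∀ x, (i:ℤ) < prodB b x ↔ (i:ℤ) < x := by
  obtain ⟨u, v, rfl⟩ := List.append_of_mem hi
  have hu : i ∉ u := by
    intro h
    have := List.disjoint_of_nodup_append hb h
    simp at this
  have hv : i ∉ v := (List.nodup_cons.1 hb.of_append_right).1
  intro H
  have := H ((prodB v).symm ((i:ℤ)+1))
  rw [prodB_append, prodB_cons, Equiv.Perm.mul_apply, Equiv.Perm.mul_apply,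
    prodB_pres i u hu, Equiv.apply_symm_apply] at this
  have h2 := prodB_pres i v hv ((prodB v).symm ((i:ℤ)+1))
  rw [Equiv.apply_symm_apply] at h2
  rw [← h2] at this
  exact sB_not_pres i (this.2 (by omega))

lemma nodup_subset {a c : List ℕ} (ha : a.Nodup) (h : prodB a = prodB c) : a ⊆ c := by
  intro i hi
  by_contra hc
  apply nodup_not_pres a ha i hi
  rw [h]
  exact prodB_pres i c hc

lemma nodup_length {a c : List ℕ} (ha : a.Nodup) (h : prodB a = prodB c) :
    a.length ≤ c.length :=
  (ha.subperm (nodup_subset ha h)).length_le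

lemma nodup_perm {a c : List ℕ} (ha : a.Nodup) (h : prodB a = prodB c)
    (hl : c.length ≤ a.length) : a.Perm c :=
  (ha.subperm (nodup_subset ha h)).perm_of_length_le hl

lemma nodup_reduced {n : ℕ} {a : List ℕ} (ha : a.Nodup) (hw : IsWordBD n a) :
    ReducedB n a (prodB a) :=
  ⟨hw, rfl, fun _ _ h => nodup_length ha h.symm⟩

lemma reduced_perm {n : ℕ} {a c : List ℕ} (ha : a.Nodup) (hw : IsWordBD n a)
    (h : ReducedB n c (prodB a)) : a.Perm c :=
  nodup_perm ha h.2.1.symm (h.2.2 a hw rfl)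

/-- far letters commute -/
lemma prodB_commute_far (m : ℕ) (w : List ℕ) (h : ∀ j ∈ w, j + 1 < m) :
    Commute (prodB w) (sB m) :=
  prodB_commute w _ fun j hj => sB_comm (h j hj)

lemma far_of_eq (m : ℕ) (y y' : List ℕ) (hn : y.Nodup) (hy : ∀ j ∈ y, j < m)
    (hy' : ∀ j ∈ y', j < m) (h : prodB y * sB m = sB m * prodB y') :
    ∀ j ∈ y, j + 1 < m := by
  intro j hj
  have hjm := hy j hj
  by_contra hc
  obtain rfl : m = j + 1 := by omega
  apply nodup_not_pres y hn j hj
  have h1 : prodB y ((j:ℤ)+1) = (j:ℤ)+1 := by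
    have := congrArg (fun g : Equiv.Perm ℤ => g ((j:ℤ)+2)) h
    simp only [Equiv.Perm.mul_apply] at this
    rw [sB_top, prodB_fix (j+1) y' hy', sB_top] at this
    · exact this
    · rw [abs_of_pos (by omega)]; push_cast; omega
  have h2 : ∀ x : ℤ, (j:ℤ) < x → prodB y x = x := by
    intro x hx
    by_cases hx1 : x = (j:ℤ)+1
    · rw [hx1, h1]
    · apply prodB_fix (j+1) y hy
      rw [abs_of_pos (by omega)]; push_cast; omega
  intro x
  constructor
  · intro hx
    have := (prodB y).injective (h2 _ hx)
    rwa [this] at hx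
  · intro hx
    rwa [h2 x hx]

lemma split_max (m : ℕ) (b : List ℕ) (hb : b.Nodup) (hm : m ∈ b) (hle : ∀ j ∈ b, j < m + 1) :
    ∃ c : List ℕ, c.Nodup ∧ (∀ j ∈ c, j < m) ∧ b.length = c.length + 1 ∧
      ((∀ S : ℕ → Bool, prodB (b.filter S) = prodB (c.filter S) * if S m then sB m else 1) ∨
       (∀ S : ℕ → Bool, prodB (b.filter S) = (if S m then sB m else 1) * prodB (c.filter S))) := by
  obtain ⟨u, v, rfl⟩ := List.append_of_mem hm
  have hp : (m :: (u ++ v)).Nodup := List.perm_middle.nodup_iff.1 hb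
  have hn := (List.nodup_cons.1 hp)
  have hlt : ∀ j ∈ u ++ v, j < m := by
    intro j hj
    have h1 := hle j (by simp only [List.mem_append, List.mem_cons] at hj ⊢; tauto)
    have h2 : j ≠ m := fun h => hn.1 (h ▸ hj)
    omega
  refine ⟨u ++ v, hn.2, hlt, by simp; omega, ?_⟩
  have hd := List.disjoint_of_nodup_append hn.2
  by_cases hv : ∀ j ∈ v, j + 1 < m
  · left
    intro S
    have hc := prodB_commute_far m (v.filter S) (fun j hj => hv j (List.mem_filter.1 hj).1)
    by_cases hS : S m
    · simp [List.filter_append, hS, mul_assoc, hc.eq]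
    · simp [List.filter_append, hS]
  · right
    have hu : ∀ j ∈ u, j + 1 < m := by
      push Not at hv
      obtain ⟨i, hi, him⟩ := hv
      have h1 := hlt i (by simp [hi])
      intro j hj
      have h2 := hlt j (by simp [hj])
      have h3 : j ≠ i := fun h => hd hj (h ▸ hi)
      omega
    intro S
    have hc := prodB_commute_far m (u.filter S) (fun j hj => hu j (List.mem_filter.1 hj).1)
    by_cases hS : S m
    · simp only [List.filter_append, List.filter_cons, hS, if_true, prodB_append, prodB_cons]
      rw [← mul_assoc, ← mul_assoc, hc.eq]
    · simp [List.filter_append, hS]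

lemma filter_true_eq (l : List ℕ) : l.filter (fun _ => true) = l := by simp

lemma filter_prod (N : ℕ) : ∀ b b' : List ℕ, b.Nodup → b'.Nodup → (∀ j ∈ b, j < N) →
    (∀ j ∈ b', j < N) → prodB b = prodB b' →
    ∀ S : ℕ → Bool, prodB (b.filter S) = prodB (b'.filter S) := by
  induction N with
  | zero =>
    intro b b' _ _ h h' _ S
    have hb : b = [] := List.eq_nil_iff_forall_not_mem.2 fun j hj => absurd (h j hj) (by omega)
    have hb' : b' = [] := List.eq_nil_iff_forall_not_mem.2 fun j hj => absurd (h' j hj) (by omega)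
    rw [hb, hb']
  | succ N ih =>
    intro b b' hb hb' h h' he S
    by_cases hN : N ∈ b
    · have hN' := nodup_subset hb he hN
      obtain ⟨c, hc, hcl, -, H⟩ := split_max N b hb hN h
      obtain ⟨c', hc', hcl', -, H'⟩ := split_max N b' hb' hN' h'
      have key : ∀ c c' : List ℕ, c.Nodup → c'.Nodup → (∀ j ∈ c, j < N) → (∀ j ∈ c', j < N) →
          prodB c * sB N = sB N * prodB c' →
          prodB (c.filter S) * (if S N then sB N else 1) =
            (if S N then sB N else 1) * prodB (c'.filter S) := by
        intro c c' hc hc' hcl hcl' e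
        have hf := far_of_eq N c c' hc hcl hcl' e
        have e2 : prodB c = prodB c' := by
          rw [(prodB_commute_far N c hf).eq] at e
          exact mul_left_cancel e
        rw [← ih c c' hc hc' hcl hcl' e2 S]
        split_ifs
        · exact (prodB_commute_far N _ (fun j hj => hf j (List.mem_filter.1 hj).1)).eq
        · simp
      rcases H with H | H <;> rcases H' with H' | H' <;>
      · have e1 := H (fun _ => true)
        have e2 := H' (fun _ => true)
        simp only [filter_true_eq, if_true] at e1 e2
        rw [e1, e2] at he
        rw [H S, H' S]
        first
        | rw [ih c c' hc hc' hcl hcl' (mul_right_cancel he) S]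
        | rw [ih c c' hc hc' hcl hcl' (mul_left_cancel he) S]
        | exact key c c' hc hc' hcl hcl' he
        | exact (key c' c hc' hc hcl' hcl he.symm).symm
    · have hN' : N ∉ b' := fun hh => hN (nodup_subset hb' he.symm hh)
      refine ih b b' hb hb' ?_ ?_ he S
      · intro j hj
        have := h j hj
        have h3 : j ≠ N := fun h => hN (h ▸ hj)
        omega
      · intro j hj
        have := h' j hj
        have h3 : j ≠ N := fun h => hN' (h ▸ hj)
        omega

lemma boolean_of_nodup (n : ℕ) (b : List ℕ) (hb : b.Nodup) (hw : IsWordBD n b) :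
    BooleanB n (prodB b) := by
  classical
  set α := {x // x ∈ b.toFinset} with hα
  let P : Finset α → ℕ → Bool := fun S j => decide (∃ x ∈ S, x.1 = j)
  have hfn : ∀ S, (b.filter (P S)).Nodup := fun S => hb.filter _
  have hfw : ∀ S, IsWordBD n (b.filter (P S)) := fun S j hj => hw j (List.mem_filter.1 hj).1
  let f : Finset α → {v : Equiv.Perm ℤ // bruhatB n v (prodB b)} := fun S =>
    ⟨prodB (b.filter (P S)), b.filter (P S), b, nodup_reduced (hfn S) (hfw S),
      nodup_reduced hb hw, List.filter_sublist⟩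
  have hf : ∀ S T, bruhatB n (f S).1 (f T).1 ↔ S ⊆ T := by
    intro S T
    constructor
    · rintro ⟨a, c, ha, hc, hs⟩
      have p1 := reduced_perm (hfn S) (hfw S) ha
      have p2 := reduced_perm (hfn T) (hfw T) hc
      intro x hx
      have : x.1 ∈ b.filter (P S) := by
        simp only [List.mem_filter, P, decide_eq_true_eq]
        exact ⟨List.mem_toFinset.1 x.2, x, hx, rfl⟩
      have := p2.symm.subset (hs.subset (p1.subset this))
      simp only [List.mem_filter, P, decide_eq_true_eq] at this
      obtain ⟨-, y, hy, hyx⟩ := this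
      rwa [← Subtype.ext hyx]
    · intro hST
      refine ⟨b.filter (P S), b.filter (P T), nodup_reduced (hfn S) (hfw S),
        nodup_reduced (hfn T) (hfw T), ?_⟩
      apply List.monotone_filter_right
      intro j hj
      simp only [P, decide_eq_true_eq] at hj ⊢
      obtain ⟨x, hx, e⟩ := hj
      exact ⟨x, hST hx, e⟩
  have hinj : Function.Injective f := by
    intro S T h
    apply Finset.Subset.antisymm
    · rw [← hf, h, hf]
    · rw [← hf, ← h, hf]
  have hsurj : Function.Surjective f := by
    rintro ⟨v, a, c, ha, hc, hs⟩
    have p := reduced_perm hb hw hc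
    have hcn : c.Nodup := p.nodup_iff.1 hb
    have hac : c.filter (· ∈ a) = a := by
      have h1 : (c.filter (· ∈ a)).Nodup := hcn.filter _
      refine (List.Sublist.eq_of_length_le ?_ ?_).symm
      · have := hs.filter (fun j => decide (j ∈ a))
        rwa [List.filter_eq_self.2 (by simp)] at this
      · apply List.Subperm.length_le
        apply h1.subperm
        intro j hj
        simpa using (List.mem_filter.1 hj).2
    refine ⟨Finset.univ.filter (fun x => x.1 ∈ a), Subtype.ext ?_⟩
    change prodB _ = v
    rw [← ha.2.1]
    have e1 : c.filter (· ∈ a) = c.filter (P (Finset.univ.filter (fun x => x.1 ∈ a))) := by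
      apply List.filter_congr
      intro j hj
      have hjb : j ∈ b := p.symm.subset hj
      simp only [P, Finset.mem_filter, Finset.mem_univ, true_and, decide_eq_decide]
      constructor
      · intro h
        exact ⟨⟨j, List.mem_toFinset.2 hjb⟩, h, rfl⟩
      · rintro ⟨x, hx, rfl⟩
        exact hx
    have e2 := congrArg prodB (hac.symm.trans e1)
    rw [e2]
    refine filter_prod (n+1) b c hb hcn ?_ ?_ hc.2.1.symm _
    · intro j hj
      have := hw j hj
      omega
    · intro j hj
      have := hc.1 j hj
      omega
  let e := Equiv.ofBijective f ⟨hinj, hsurj⟩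
  let g : α ≃ Fin b.toFinset.card := b.toFinset.equivFin
  refine ⟨b.toFinset.card, e.symm.trans g.finsetCongr, ?_⟩
  intro x y
  obtain ⟨S, rfl⟩ := e.surjective x
  obtain ⟨T, rfl⟩ := e.surjective y
  simp only [Equiv.trans_apply, Equiv.symm_apply_apply, Equiv.finsetCongr_apply,
    Finset.map_subset_map]
  exact hf S T

lemma sB_not_comm (i : ℕ) : sB i * sB (i+1) ≠ sB (i+1) * sB i := by
  intro h
  have := far_of_eq (i+1) [i] [i] (by simp) (by simp) (by simp) (by simpa using h) i (by simp)
  omega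

lemma sublist_pair {i j : ℕ} {a : List ℕ} (h : a.Sublist [i, j]) :
    a = [] ∨ a = [i] ∨ a = [j] ∨ a = [i, j] := by
  have := List.mem_sublists.2 h
  simp [List.sublists] at this
  tauto

lemma pair_aux {n : ℕ} {w : Equiv.Perm ℤ} {r : ℕ}
    (e : {v : Equiv.Perm ℤ // bruhatB n v w} ≃ Finset (Fin r))
    (he : ∀ a b : {v : Equiv.Perm ℤ // bruhatB n v w}, bruhatB n a.1 b.1 ↔ e a ⊆ e b)
    (b : List ℕ) (hb : ReducedB n b w) (i j : ℕ) (hij : i ≠ j)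
    (hc : sB i * sB j ≠ sB j * sB i)
    (h1 : [i, j].Sublist b)
    (X Y : {v : Equiv.Perm ℤ // bruhatB n v w}) (hX : X.1 = prodB [i, j])
    (hY : Y.1 = prodB [j, i]) : e X ⊆ e Y := by
  have hi : i ≤ n - 1 := hb.1 i (h1.subset (by simp))
  have hj : j ≤ n - 1 := hb.1 j (h1.subset (by simp))
  have r0 : ReducedB n [] (prodB []) := nodup_reduced (by simp) (by simp [IsWordBD])
  have ri : ReducedB n [i] (prodB [i]) := nodup_reduced (by simp) (by simpa [IsWordBD])
  have rj : ReducedB n [j] (prodB [j]) := nodup_reduced (by simp) (by simpa [IsWordBD])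
  have wij : IsWordBD n [i, j] := by simp [IsWordBD, hi, hj]
  have rij : ReducedB n [i, j] (prodB [i, j]) := nodup_reduced (by simp [hij]) wij
  have rji : ReducedB n [j, i] (prodB [j, i]) :=
    nodup_reduced (by simp [hij.symm]) (by simp [IsWordBD, hi, hj])
  have si : [i].Sublist [i, j] := by simp
  have sj : [j].Sublist [i, j] := by simp
  have hred : ∀ c, ReducedB n c (prodB [i, j]) → c = [i, j] := by
    intro c hcr
    have p := reduced_perm (by simp [hij]) wij hcr
    have hl := p.length_eq
    match c, hl with
    | [x, y], _ =>
      have hx : x ∈ [i, j] := p.symm.subset (by simp)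
      have hy : y ∈ [i, j] := p.symm.subset (by simp)
      have hnd : [x, y].Nodup := p.nodup_iff.1 (by simp [hij])
      have e2 := hcr.2.1
      simp only [List.mem_cons, List.not_mem_nil, or_false] at hx hy
      simp only [List.nodup_cons, List.mem_cons, List.not_mem_nil, or_false] at hnd
      rcases hx with rfl | rfl <;> rcases hy with rfl | rfl
      · simp at hnd
      · rfl
      · exact absurd (by simpa using e2.symm) hc
      · simp at hnd
  intro p hp
  obtain ⟨V, hV⟩ := e.surjective {p}
  have hVX : bruhatB n V.1 X.1 := by rw [he, hV]; simpa using hp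
  rw [← Finset.singleton_subset_iff, ← hV, ← he, hY]
  obtain ⟨a, c, ha, hcr, hs⟩ := hVX
  rw [hX] at hcr
  rw [hred c hcr] at hs
  rcases sublist_pair hs with rfl | rfl | rfl | rfl
  · exact ⟨_, _, ha, rji, by simp⟩
  · exact ⟨_, _, ha, rji, by simp⟩
  · exact ⟨_, _, ha, rji, by simp⟩
  · exfalso
    have hVX : V = X := Subtype.ext (by rw [← ha.2.1, hX])
    subst hVX
    let I : {v : Equiv.Perm ℤ // bruhatB n v w} := ⟨prodB [i], [i], b, ri, hb, si.trans h1⟩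
    let J : {v : Equiv.Perm ℤ // bruhatB n v w} := ⟨prodB [j], [j], b, rj, hb, sj.trans h1⟩
    have hI : e I ⊆ {p} := by rw [← hV, ← he, hX]; exact ⟨_, _, ri, rij, si⟩
    have hJ : e J ⊆ {p} := by rw [← hV, ← he, hX]; exact ⟨_, _, rj, rij, sj⟩
    have hlen : ∀ k, prodB [i, j] ≠ prodB [k] := by
      intro k hk
      have := nodup_length (by simp [hij]) hk
      simp at this
    have nI : e I ≠ {p} := by
      rw [← hV]
      intro h
      have := congrArg Subtype.val (e.injective h)
      rw [hX] at this
      exact hlen i this.symm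
    have nJ : e J ≠ {p} := by
      rw [← hV]
      intro h
      have := congrArg Subtype.val (e.injective h)
      rw [hX] at this
      exact hlen j this.symm
    have hI0 := (Finset.subset_singleton_iff.1 hI).resolve_right nI
    have hJ0 := (Finset.subset_singleton_iff.1 hJ).resolve_right nJ
    have := congrArg Subtype.val (e.injective (hI0.trans hJ0.symm))
    have := nodup_subset (a := [i]) (c := [j]) (by simp) this (by simp : i ∈ [i])
    simp at this
    exact hij this

lemma nodup_of_boolean {n : ℕ} {w : Equiv.Perm ℤ} (h : BooleanB n w) :
    ∃ b : List ℕ, b.Nodup ∧ IsWordBD n b ∧ prodB b = w := by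
  obtain ⟨r, e, he⟩ := h
  obtain ⟨_, b, -, hb, -⟩ := (e.symm ∅).2
  refine ⟨b, ?_, hb.1, hb.2.1⟩
  rw [List.nodup_iff_sublist]
  intro i hi
  obtain ⟨p, t, rfl, hp, ht⟩ := List.cons_sublist_iff.1 hi
  rw [List.singleton_sublist] at ht
  obtain ⟨p1, p2, rfl⟩ := List.append_of_mem hp
  obtain ⟨t1, t2, rfl⟩ := List.append_of_mem ht
  set u := p2 ++ t1 with hu
  have hbe : p1 ++ i :: p2 ++ (t1 ++ i :: t2) = p1 ++ (i :: u ++ i :: t2) := by simp [hu]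
  rw [hbe] at hb
  by_cases hfar : ∀ j ∈ u, Commute (sB j) (sB i)
  · have hcm := prodB_commute u _ hfar
    have hlt := hb.2.2 (p1 ++ u ++ t2) (fun j hj => hb.1 j (by
      simp only [List.mem_append, List.mem_cons] at hj ⊢; tauto)) (by
      rw [← hb.2.1]
      simp only [prodB_append, prodB_cons, mul_assoc]
      rw [← mul_assoc (prodB u) (sB i), hcm.eq, mul_assoc, ← mul_assoc (sB i) (sB i), sB_sq,
        one_mul])
    simp at hlt
  · push Not at hfar
    obtain ⟨j, hj, hcj⟩ := hfar
    have hij : i ≠ j := by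
      rintro rfl
      exact hcj (Commute.refl _)
    obtain ⟨u1, u2, hu12⟩ := List.append_of_mem hj
    have s1 : [i, j].Sublist (p1 ++ (i :: u ++ i :: t2)) := by
      refine List.Sublist.trans ?_ (List.sublist_append_right _ _)
      refine List.Sublist.trans ?_ (List.sublist_append_left _ _)
      exact List.Sublist.cons_cons _ (List.singleton_sublist.2 hj)
    have s2 : [j, i].Sublist (p1 ++ (i :: u ++ i :: t2)) := by
      refine List.Sublist.trans ?_ (List.sublist_append_right _ _)
      exact List.Sublist.append (l₁ := [j]) (r₁ := [i])
        (List.singleton_sublist.2 (by simp [hj])) (List.singleton_sublist.2 (by simp))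
    have hi' : i ≤ n - 1 := hb.1 i (s1.subset (by simp))
    have hj' : j ≤ n - 1 := hb.1 j (s1.subset (by simp))
    have hc1 : sB i * sB j ≠ sB j * sB i := fun h => hcj h.symm
    let X : {v : Equiv.Perm ℤ // bruhatB n v w} := ⟨prodB [i, j], _, _,
      nodup_reduced (by simp [hij]) (by simp [IsWordBD, hi', hj']), hb, s1⟩
    let Y : {v : Equiv.Perm ℤ // bruhatB n v w} := ⟨prodB [j, i], _, _,
      nodup_reduced (by simp [hij.symm]) (by simp [IsWordBD, hi', hj']), hb, s2⟩
    have h1 := pair_aux e he _ hb i j hij hc1 s1 X Y rfl rfl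
    have h2 := pair_aux e he _ hb j i hij.symm hc1.symm s2 Y X rfl rfl
    have := congrArg Subtype.val (e.injective (Finset.Subset.antisymm h1 h2))
    exact hc1 (by simpa [X, Y] using this)

/-- products of repetition-free words of length `k` in the letters `< n` -/
def CS (n k : ℕ) : Set (Equiv.Perm ℤ) :=
  {x | ∃ b : List ℕ, b.Nodup ∧ (∀ j ∈ b, j < n) ∧ b.length = k ∧ prodB b = x}

lemma set_eq (n k : ℕ) (hn : 1 ≤ n) :
    {w : Equiv.Perm ℤ | IsSignedPerm n w ∧ BooleanB n w ∧ lenB n w = k} = CS n k := by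
  have hl : ∀ b : List ℕ, b.Nodup → IsWordBD n b → lenB n (prodB b) = b.length := by
    intro b hb hw
    apply le_antisymm
    · exact Nat.sInf_le ⟨b, hw, rfl, rfl⟩
    · refine le_csInf ⟨_, b, hw, rfl, rfl⟩ ?_
      rintro l ⟨c, -, hc, rfl⟩
      exact nodup_length hb hc.symm
  ext w
  constructor
  · rintro ⟨-, hB, rfl⟩
    obtain ⟨b, hb, hw, rfl⟩ := nodup_of_boolean hB
    refine ⟨b, hb, fun j hj => ?_, (hl b hb hw).symm, rfl⟩
    have := hw j hj
    omega
  · rintro ⟨b, hb, hlt, rfl, rfl⟩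
    have hw : IsWordBD n b := fun j hj => by
      have := hlt j hj
      omega
    exact ⟨⟨prodB_neg b, prodB_fix n b hlt⟩, boolean_of_nodup n b hb hw, hl b hb hw⟩

lemma CS_zero_right (n : ℕ) : CS n 0 = {1} := by
  ext x
  constructor
  · rintro ⟨b, -, -, h, rfl⟩
    rw [List.length_eq_zero_iff.1 h]
    rfl
  · rintro rfl
    exact ⟨[], by simp, by simp, rfl, rfl⟩

lemma CS_zero_left (k : ℕ) : CS 0 (k+1) = ∅ := by
  ext x
  simp only [Set.mem_empty_iff_false, iff_false]
  rintro ⟨b, -, h, hl, -⟩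
  match b, hl with
  | a :: b, _ => exact absurd (h a (by simp)) (by omega)

lemma CS_succ (n k : ℕ) : CS (n+1) (k+1) =
    CS n (k+1) ∪ (Set.image (fun x => x * sB n) (CS n k) ∪ Set.image (fun x => sB n * x) (CS n k)) := by
  ext x
  constructor
  · rintro ⟨b, hb, hlt, hl, rfl⟩
    by_cases hn : n ∈ b
    · right
      obtain ⟨c, hc, hcl, hlen, H⟩ := split_max n b hb hn hlt
      have hm : prodB c ∈ CS n k := ⟨c, hc, hcl, by omega, rfl⟩
      rcases H with H | H
      · left
        refine ⟨_, hm, ?_⟩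
        have := H (fun _ => true)
        simpa using this.symm
      · right
        refine ⟨_, hm, ?_⟩
        have := H (fun _ => true)
        simpa using this.symm
    · left
      refine ⟨b, hb, fun j hj => ?_, hl, rfl⟩
      have := hlt j hj
      have h3 : j ≠ n := fun h => hn (h ▸ hj)
      omega
  · rintro (⟨b, hb, hlt, hl, rfl⟩ | ⟨_, ⟨b, hb, hlt, hl, rfl⟩, rfl⟩ | ⟨_, ⟨b, hb, hlt, hl, rfl⟩, rfl⟩)
    · exact ⟨b, hb, fun j hj => (hlt j hj).trans (by omega), hl, rfl⟩
    · have hnb : n ∉ b := fun h => absurd (hlt n h) (by omega)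
      refine ⟨b ++ [n], ?_, ?_, by simp [hl], by simp⟩
      · rw [(List.perm_append_comm (l₁ := b) (l₂ := [n])).nodup_iff]
        simp [hnb, hb]
      · intro j hj
        simp only [List.mem_append, List.mem_singleton] at hj
        rcases hj with hj | rfl
        · exact (hlt j hj).trans (by omega)
        · omega
    · have hnb : n ∉ b := fun h => absurd (hlt n h) (by omega)
      refine ⟨n :: b, by simp [hnb, hb], ?_, by simp [hl], by simp⟩
      intro j hj
      simp only [List.mem_cons] at hj
      rcases hj with rfl | hj
      · omega
      · exact (hlt j hj).trans (by omega)

lemma CS_finite (n : ℕ) : ∀ k, (CS n k).Finite := by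
  induction n with
  | zero =>
    intro k
    cases k with
    | zero => rw [CS_zero_right]; exact Set.finite_singleton _
    | succ k => rw [CS_zero_left]; exact Set.finite_empty
  | succ n ih =>
    intro k
    cases k with
    | zero => rw [CS_zero_right]; exact Set.finite_singleton _
    | succ k =>
      rw [CS_succ]
      exact (ih _).union (((ih _).image _).union ((ih _).image _))

lemma CS_disj (n k : ℕ) : Disjoint (CS n (k+1))
    (Set.image (fun x => x * sB n) (CS n k) ∪ Set.image (fun x => sB n * x) (CS n k)) := by
  have hno : ∀ b c : List ℕ, n ∉ b → c.Nodup → n ∈ c → prodB c = prodB b → False := by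
    intro b c hb hc hn h
    exact hb (nodup_subset hc h hn)
  rw [Set.disjoint_left]
  rintro x ⟨b, hb, hlt, hl, rfl⟩ (⟨_, ⟨c, hc, hlt', hl', rfl⟩, h⟩ | ⟨_, ⟨c, hc, hlt', hl', rfl⟩, h⟩)
  · have hnb : n ∉ b := fun h => absurd (hlt n h) (by omega)
    have hnc : n ∉ c := fun h => absurd (hlt' n h) (by omega)
    refine hno b (c ++ [n]) hnb ?_ (by simp) (by simpa using h)
    rw [(List.perm_append_comm (l₁ := c) (l₂ := [n])).nodup_iff]
    simp [hnc, hc]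
  · have hnb : n ∉ b := fun h => absurd (hlt n h) (by omega)
    have hnc : n ∉ c := fun h => absurd (hlt' n h) (by omega)
    exact hno b (n :: c) hnb (by simp [hnc, hc]) (by simp) (by simpa using h)

lemma CS_inter (m k : ℕ) :
    Set.image (fun x => x * sB (m+1)) (CS (m+1) k) ∩ Set.image (fun x => sB (m+1) * x) (CS (m+1) k) =
      Set.image (fun x => x * sB (m+1)) (CS m k) := by
  ext x
  constructor
  · rintro ⟨⟨_, ⟨b, hb, hlt, hl, rfl⟩, rfl⟩, ⟨_, ⟨c, hc, hlt', hl', rfl⟩, h⟩⟩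
    have := far_of_eq (m+1) b c hb hlt hlt' h.symm
    exact ⟨_, ⟨b, hb, fun j hj => by have := this j hj; omega, hl, rfl⟩, rfl⟩
  · rintro ⟨_, ⟨b, hb, hlt, hl, rfl⟩, rfl⟩
    have hm : prodB b ∈ CS (m+1) k := ⟨b, hb, fun j hj => (hlt j hj).trans (by omega), hl, rfl⟩
    refine ⟨⟨_, hm, rfl⟩, ⟨_, hm, ?_⟩⟩
    exact (prodB_commute_far (m+1) b (fun j hj => by have := hlt j hj; omega)).eq.symm

lemma card_rec (m k : ℕ) : (CS (m+2) (k+1)).ncard + (CS m k).ncard =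
    (CS (m+1) (k+1)).ncard + 2 * (CS (m+1) k).ncard := by
  have fR := (CS_finite (m+1) k).image (fun x => x * sB (m+1))
  have fL := (CS_finite (m+1) k).image (fun x => sB (m+1) * x)
  rw [CS_succ (m+1) k, Set.ncard_union_eq (CS_disj _ _) (CS_finite _ _) (fR.union fL)]
  have h := Set.ncard_union_add_ncard_inter _ _ fR fL
  rw [CS_inter, Set.ncard_image_of_injective _ (mul_left_injective _),
    Set.ncard_image_of_injective _ (mul_left_injective _),
    Set.ncard_image_of_injective _ (mul_right_injective _)] at h
  omega

lemma card_one (k : ℕ) : (CS 1 (k+1)).ncard = if k = 0 then 1 else 0 := by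
  rw [CS_succ, CS_zero_left]
  cases k with
  | zero => simp [CS_zero_right]
  | succ k => simp [CS_zero_left]

/-- the formula, with shifted index -/
def GF (n k : ℕ) : ℕ := ∑ j ∈ Finset.range (k+1), Nat.choose (n - j) (k + 1 - j) * Nat.choose k j

lemma GF_succ (n k : ℕ) : GF n (k+1) = ∑ j ∈ Finset.range (k+1),
    (Nat.choose (n - j) (k + 2 - j) + Nat.choose (n - (j+1)) (k + 1 - j)) * Nat.choose k j := by
  unfold GF
  rw [Finset.sum_range_succ']
  simp only [Nat.choose_succ_succ, mul_add, add_mul, Finset.sum_add_distrib]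
  have h1 : ∑ j ∈ Finset.range (k+1), Nat.choose (n - j) (k + 2 - j) * Nat.choose k j =
      ∑ j ∈ Finset.range (k+1), Nat.choose (n - (j+1)) (k + 1 + 1 - (j+1)) * Nat.choose k (j+1) +
        Nat.choose (n - 0) (k + 1 + 1 - 0) * Nat.choose (k+1) 0 := by
    have := Finset.sum_range_succ' (fun j => Nat.choose (n - j) (k + 2 - j) * Nat.choose k j) (k+1)
    rw [Finset.sum_range_succ] at this
    simpa using this
  rw [h1]
  simp only [Nat.add_sub_add_right]
  ring

lemma GF_rec (n k : ℕ) : GF (n+2) (k+1) + GF n k = GF (n+1) (k+1) + 2 * GF (n+1) k := by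
  rw [GF_succ, GF_succ]
  unfold GF
  rw [Finset.mul_sum, ← Finset.sum_add_distrib, ← Finset.sum_add_distrib]
  apply Finset.sum_congr rfl
  intro j hj
  have hj := Finset.mem_range.1 hj
  have hk : k + 2 - j = (k + 1 - j) + 1 := by omega
  obtain ⟨q, hq⟩ : ∃ q, k + 1 - j = q + 1 := ⟨k - j, by omega⟩
  rw [hk, show n + 2 - (j + 1) = n + 1 - j by omega, show n + 1 - (j + 1) = n - j by omega, hq]
  by_cases hjn : j ≤ n + 1
  · rw [show n + 2 - j = (n + 1 - j) + 1 by omega, Nat.choose_succ_succ (n + 1 - j) (q+1)]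
    ring
  · rw [show n + 2 - j = 0 by omega, show n + 1 - j = 0 by omega, show n - j = 0 by omega]
    simp

lemma card_eq (k : ℕ) : ∀ n, (CS n (k+1)).ncard = GF n k := by
  induction k with
  | zero =>
    intro n
    have h0 : GF n 0 = n := by simp [GF]
    rw [h0]
    induction n using Nat.twoStepInduction with
    | zero => simp [CS_zero_left]
    | one => simp [card_one]
    | more m _ ih =>
      have := card_rec m 0
      rw [ih (by simp [GF])] at this
      simp only [CS_zero_right, Set.ncard_singleton] at this
      omega
  | succ k ihk =>
    intro n
    induction n using Nat.twoStepInduction with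
    | zero =>
      rw [CS_zero_left, Set.ncard_empty, GF]
      symm
      apply Finset.sum_eq_zero
      intro j hj
      have := Finset.mem_range.1 hj
      rw [Nat.choose_eq_zero_of_lt (by omega), zero_mul]
    | one =>
      rw [card_one, GF]
      simp only [Nat.add_eq_zero_iff, one_ne_zero, and_false, if_false]
      symm
      apply Finset.sum_eq_zero
      intro j hj
      have := Finset.mem_range.1 hj
      by_cases h : j = 0
      · rw [Nat.choose_eq_zero_of_lt (by omega), zero_mul]
      · rw [Nat.choose_eq_zero_of_lt (by omega), zero_mul]
    | more m _ ih =>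
      have h1 := card_rec m (k+1)
      have h2 := GF_rec m k
      rw [ih, ihk, ihk] at h1
      omega

theorem stmt17 (n k : ℕ) (hn : 1 ≤ n) :
    (1 ≤ k →
      Nat.card {w : Equiv.Perm ℤ // IsSignedPerm n w ∧ BooleanB n w ∧ lenB n w = k} =
        ∑ i ∈ Finset.Icc 1 k, Nat.choose (n + 1 - i) (k + 1 - i) * Nat.choose (k - 1) (i - 1)) ∧
    Nat.card {w : Equiv.Perm ℤ // IsSignedPerm n w ∧ BooleanB n w ∧ lenB n w = 0} = 1 := by
  have hcard : ∀ m, Nat.card {w : Equiv.Perm ℤ // IsSignedPerm n w ∧ BooleanB n w ∧ lenB n w = m} =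
      (CS n m).ncard := by
    intro m
    rw [← set_eq n m hn]
    rfl
  refine ⟨fun hk => ?_, ?_⟩
  · obtain ⟨k, rfl⟩ : ∃ k', k = k' + 1 := ⟨k - 1, by omega⟩
    rw [hcard, card_eq, GF, Finset.range_eq_Ico, Finset.sum_Ico_eq_sum_range]
    rw [← Finset.Ico_add_one_right_eq_Icc, Finset.sum_Ico_eq_sum_range]
    refine Finset.sum_congr (by simp) ?_
    intro j _
    rw [show n + 1 - (1 + j) = n - (0 + j) by omega,
      show k + 1 + 1 - (1 + j) = k + 1 - (0 + j) by omega,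
      show 1 + j - 1 = 0 + j by omega]
    rfl
  · rw [hcard, CS_zero_right, Set.ncard_singleton]
end Paper
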